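/- Let σ_D, σ_E > 0. In the regime of small amplitude constraint, the secret-key capacity behaves like the capacity of the legitimate user's channel without any secrecy constraint: lim_{A → 0⁺} C_k(A) / (A²/(2σ_D²)) = 1. -/

import Mathlib

open MeasureTheory ProbabilityTheory Real Filter Set
open scoped Classical

noncomputable section

/-- Kullback–Leibler divergence of `μ` from `ν` (valued in `EReal`; `⊤` when undefined). -/
def klDiv {α : Type*} [MeasurableSpace α] (μ ν : Measure α) : EReal :=
  if μ ≪ ν ∧ Integrable (llr μ ν) μ then ((∫ x, llr μ ν x ∂μ : ℝ) : EReal) else ⊤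

/-- Mutual information `I(U;V)` under `P`: the KL divergence of the joint law of `(U,V)`
from the product of its marginal laws. -/
def mutualInfo {Ω α β : Type*} [MeasurableSpace Ω] [MeasurableSpace α] [MeasurableSpace β]
    (P : Measure Ω) (U : Ω → α) (V : Ω → β) : EReal :=
  klDiv (P.map (fun ω => (U ω, V ω))) ((P.map U).prod (P.map V))

/-- Joint law of `(X, N_D, N_E)` where `X ~ μ`, `N_D ~ N(0,σD²)`, `N_E ~ N(0,σE²)` are
mutually independent. -/
def chan (μ : Measure ℝ) (σD σE : ℝ) : Measure (ℝ × ℝ × ℝ) :=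
  μ.prod ((gaussianReal 0 (σD ^ 2).toNNReal).prod (gaussianReal 0 (σE ^ 2).toNNReal))

/-- The channel input `X`. -/
def Xc : ℝ × ℝ × ℝ → ℝ := fun ω => ω.1
/-- The legitimate receiver's observation `Y = X + N_D`. -/
def Yc : ℝ × ℝ × ℝ → ℝ := fun ω => ω.1 + ω.2.1
/-- The eavesdropper's observation `Z = X + N_E`. -/
def Zc : ℝ × ℝ × ℝ → ℝ := fun ω => ω.1 + ω.2.2

/-- The secret-key rate `I(X;(Y,Z)) − I(X;Z)` for input distribution `μ`. -/
def skRate (σD σE : ℝ) (μ : Measure ℝ) : EReal :=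
  mutualInfo (chan μ σD σE) Xc (fun ω => (Yc ω, Zc ω)) - mutualInfo (chan μ σD σE) Xc Zc

/-- Secret-key capacity with amplitude constraint `A`. -/
def Ck (σD σE A : ℝ) : EReal :=
  sSup {r : EReal | ∃ μ : Measure ℝ, IsProbabilityMeasure μ ∧ μ (Set.Icc (-A) A)ᶜ = 0 ∧
    r = skRate σD σE μ}

/-- If `(U, V)` has density `e` with respect to `law U ⊗ γ`, then `V` has density the average
of `e` over the law of `U`. -/
lemma map_snd_eq_withDensity {Ω α β : Type*} [MeasurableSpace Ω] [MeasurableSpace α]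
    [MeasurableSpace β] {P : Measure Ω} [IsProbabilityMeasure P] {U : Ω → α} {V : Ω → β}
    (hU : Measurable U) (hV : Measurable V) {γ : Measure β} [IsProbabilityMeasure γ]
    {e : α × β → ℝ} (he : Measurable e) {m : β → ℝ}
    (hm : ∀ w, ∫⁻ x, ENNReal.ofReal (e (x, w)) ∂(P.map U) = ENNReal.ofReal (m w))
    (hJ : P.map (fun ω => (U ω, V ω)) =
      ((P.map U).prod γ).withDensity (fun p => ENNReal.ofReal (e p))) :
    P.map V = γ.withDensity (fun w => ENNReal.ofReal (m w)) := by
  have : IsProbabilityMeasure (P.map U) := Measure.isProbabilityMeasure_map hU.aemeasurable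
  have h1 : P.map V = (P.map (fun ω => (U ω, V ω))).map Prod.snd := by
    rw [Measure.map_map measurable_snd (hU.prodMk hV)]; rfl
  refine Measure.ext_of_lintegral _ fun f hf => ?_
  have hmeas : Measurable (fun w => ENNReal.ofReal (m w)) := by
    simp_rw [← hm]
    exact Measurable.lintegral_prod_left' (f := fun p : α × β => ENNReal.ofReal (e p)) (by fun_prop)
  rw [h1, lintegral_map hf measurable_snd, hJ,
    lintegral_withDensity_eq_lintegral_mul _ (by fun_prop) (by fun_prop),
    lintegral_withDensity_eq_lintegral_mul _ hmeas hf, lintegral_prod_symm' _ (by fun_prop)]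
  refine lintegral_congr fun w => ?_
  simp only [Pi.mul_apply]
  rw [lintegral_mul_const _ (by fun_prop), hm]

lemma mutualInfo_eq_integral_log {Ω α β : Type*} [MeasurableSpace Ω] [MeasurableSpace α]
    [MeasurableSpace β] {P : Measure Ω} [IsProbabilityMeasure P] {U : Ω → α} {V : Ω → β}
    (hU : Measurable U) (hV : Measurable V) {γ : Measure β} [IsProbabilityMeasure γ]
    {e : α × β → ℝ} (he : Measurable e) (he0 : ∀ p, 0 < e p) {m : β → ℝ} (hmm : Measurable m)
    (hm0 : ∀ w, 0 < m w)
    (hm : ∀ w, ∫⁻ x, ENNReal.ofReal (e (x, w)) ∂(P.map U) = ENNReal.ofReal (m w))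
    (hJ : P.map (fun ω => (U ω, V ω)) =
      ((P.map U).prod γ).withDensity (fun p => ENNReal.ofReal (e p)))
    (h_int : Integrable (fun ω => log (e (U ω, V ω)) - log (m (V ω))) P) :
    mutualInfo P U V = ((∫ ω, (log (e (U ω, V ω)) - log (m (V ω))) ∂P : ℝ) : EReal) := by
  have : IsProbabilityMeasure (P.map U) := Measure.isProbabilityMeasure_map hU.aemeasurable
  have : IsProbabilityMeasure (P.map V) := Measure.isProbabilityMeasure_map hV.aemeasurable
  have hV' := map_snd_eq_withDensity hU hV he hm hJ
  set ν := (P.map U).prod (P.map V) with hν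
  have hJν : P.map (fun ω => (U ω, V ω)) =
      ν.withDensity (fun p => ENNReal.ofReal (e p / m p.2)) := by
    rw [hJ, hν, hV', prod_withDensity_right (by fun_prop), ← withDensity_mul _ (by fun_prop)
      (by fun_prop)]
    congr 1
    ext p
    rw [Pi.mul_apply, ← ENNReal.ofReal_mul (hm0 _).le, mul_div_cancel₀ _ (hm0 _).ne']
  have hac : P.map (fun ω => (U ω, V ω)) ≪ ν := hJν ▸ withDensity_absolutelyContinuous _ _
  have hllr : llr (P.map (fun ω => (U ω, V ω))) ν =ᵐ[P.map (fun ω => (U ω, V ω))]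
      fun p => log (e p) - log (m p.2) := by
    have h := Measure.rnDeriv_withDensity ν
      (f := fun p => ENNReal.ofReal (e p / m p.2)) (by fun_prop)
    rw [← hJν] at h
    filter_upwards [hac.ae_le h] with p hp
    rw [llr, hp, ENNReal.toReal_ofReal (div_pos (he0 _) (hm0 _)).le,
      log_div (he0 _).ne' (hm0 _).ne']
  have hmeas : Measurable fun p : α × β => log (e p) - log (m p.2) := by fun_prop
  have hUV : Measurable fun ω => (U ω, V ω) := hU.prodMk hV
  have h_int' : Integrable (llr (P.map (fun ω => (U ω, V ω))) ν) (P.map (fun ω => (U ω, V ω))) := by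
    rw [integrable_congr hllr, integrable_map_measure hmeas.aestronglyMeasurable hUV.aemeasurable]
    exact h_int
  rw [mutualInfo, klDiv, if_pos ⟨hac, h_int'⟩, integral_congr_ae hllr,
    integral_map hUV.aemeasurable hmeas.aestronglyMeasurable]

/-- Gibbs' inequality for a random variable with density `a` against another density `b`. -/
lemma integral_log_sub_log_nonneg {Ω β : Type*} [MeasurableSpace Ω] [MeasurableSpace β]
    {P : Measure Ω} [IsProbabilityMeasure P] {V : Ω → β} (hV : Measurable V) {γ : Measure β}
    {a b : β → ℝ} (ha : Measurable a) (hb : Measurable b)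
    (ha0 : ∀ w, 0 < a w) (hb0 : ∀ w, 0 < b w)
    (hVa : P.map V = γ.withDensity (fun w => ENNReal.ofReal (a w)))
    (hb1 : ∫⁻ w, ENNReal.ofReal (b w) ∂γ = 1)
    (h_int : Integrable (fun ω => log (a (V ω)) - log (b (V ω))) P) :
    0 ≤ ∫ ω, (log (a (V ω)) - log (b (V ω))) ∂P := by
  have h1 : ∫⁻ ω, ENNReal.ofReal (b (V ω) / a (V ω)) ∂P = 1 := by
    rw [← lintegral_map (f := fun w => ENNReal.ofReal (b w / a w)) (by fun_prop) hV, hVa,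
      lintegral_withDensity_eq_lintegral_mul _ (by fun_prop) (by fun_prop), ← hb1]
    refine lintegral_congr fun w => ?_
    rw [Pi.mul_apply, ← ENNReal.ofReal_mul (ha0 _).le, mul_div_cancel₀ _ (ha0 _).ne']
  have h0 : ∀ ω, 0 ≤ b (V ω) / a (V ω) := fun ω => (div_pos (hb0 _) (ha0 _)).le
  have hmeas : Measurable fun ω => b (V ω) / a (V ω) := by fun_prop
  have h2 : Integrable (fun ω => b (V ω) / a (V ω)) P := by
    refine ⟨hmeas.aestronglyMeasurable, ?_⟩
    rw [hasFiniteIntegral_iff_ofReal (ae_of_all _ h0), h1]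
    exact ENNReal.one_lt_top
  have h3 : ∫ ω, b (V ω) / a (V ω) ∂P = 1 := by
    rw [integral_eq_lintegral_of_nonneg_ae (ae_of_all _ h0) hmeas.aestronglyMeasurable, h1]
    simp
  calc (0 : ℝ) = ∫ ω, (1 - b (V ω) / a (V ω)) ∂P := by
        rw [integral_sub (integrable_const _) h2, h3]; simp
    _ ≤ _ := by
        refine integral_mono ((integrable_const _).sub h2) h_int fun ω => ?_
        have := one_sub_inv_le_log_of_pos (div_pos (ha0 (V ω)) (hb0 (V ω)))
        rwa [inv_div, log_div (ha0 _).ne' (hb0 _).ne'] at this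

/-- The likelihood ratio of `N(x, v)` to `N(0, v)`. -/
def gaussianRatio (v x y : ℝ) : ℝ := rexp ((x * y - x ^ 2 / 2) / v)

lemma gaussianRatio_pos (v x y : ℝ) : 0 < gaussianRatio v x y := exp_pos _

@[fun_prop]
lemma Measurable.gaussianRatio {α : Type*} [MeasurableSpace α] {f g : α → ℝ} (v : ℝ)
    (hf : Measurable f) (hg : Measurable g) :
    Measurable fun a => gaussianRatio v (f a) (g a) := by
  unfold _root_.gaussianRatio; fun_prop

lemma gaussianReal_eq_withDensity_gaussianRatio (x : ℝ) {v : NNReal} (hv : v ≠ 0) :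
    gaussianReal x v =
      (gaussianReal 0 v).withDensity (fun y => ENNReal.ofReal (gaussianRatio v x y)) := by
  rw [gaussianReal_of_var_ne_zero _ hv, gaussianReal_of_var_ne_zero _ hv,
    ← withDensity_mul _ (by fun_prop) (by fun_prop)]
  congr 1
  ext y
  have hv' : (v : ℝ) ≠ 0 := by exact_mod_cast hv
  rw [Pi.mul_apply, gaussianPDF, gaussianPDF, ← ENNReal.ofReal_mul (gaussianPDFReal_nonneg _ _ _),
    gaussianPDFReal, gaussianPDFReal, gaussianRatio, mul_assoc _ (rexp _), ← exp_add]
  congr 3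
  field_simp
  ring

/-- Shifting a centred Gaussian by `x` amounts to weighting it by the likelihood ratio. -/
lemma lintegral_add_gaussianReal (x : ℝ) {v : NNReal} (hv : v ≠ 0) {f : ℝ → ENNReal}
    (hf : Measurable f) :
    ∫⁻ n, f (x + n) ∂gaussianReal 0 v =
      ∫⁻ y, ENNReal.ofReal (gaussianRatio v x y) * f y ∂gaussianReal 0 v := by
  rw [← lintegral_map (g := fun n => x + n) hf (by fun_prop), gaussianReal_map_const_add, zero_add,
    gaussianReal_eq_withDensity_gaussianRatio x hv,
    lintegral_withDensity_eq_lintegral_mul _ (by fun_prop) hf]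
  rfl

lemma lintegral_gaussianRatio (x : ℝ) {v : NNReal} (hv : v ≠ 0) :
    ∫⁻ y, ENNReal.ofReal (gaussianRatio v x y) ∂gaussianReal 0 v = 1 := by
  simpa using (lintegral_add_gaussianReal x hv (f := fun _ => 1) measurable_const).symm

lemma abs_log_gaussianRatio_le {A v x : ℝ} (hv : 0 < v) (hx : x ∈ Icc (-A) A) (y : ℝ) :
    |log (gaussianRatio v x y)| ≤ (A * |y| + A ^ 2 / 2) / v := by
  rw [gaussianRatio, log_exp, abs_div, abs_of_pos hv]
  have hxA : |x| ≤ A := abs_le.2 hx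
  have hx2 : x ^ 2 ≤ A ^ 2 := sq_le_sq' hx.1 hx.2
  gcongr
  calc |x * y - x ^ 2 / 2| ≤ |x * y| + |x ^ 2 / 2| := abs_sub _ _
    _ = |x| * |y| + x ^ 2 / 2 := by rw [abs_mul, abs_of_nonneg (by positivity : 0 ≤ x ^ 2 / 2)]
    _ ≤ A * |y| + A ^ 2 / 2 := by gcongr

lemma ae_mem_of_measure_compl {α : Type*} [MeasurableSpace α] {μ : Measure α} {s : Set α}
    (h : μ sᶜ = 0) : ∀ᵐ x ∂μ, x ∈ s := h

section Average

variable {β : Type*} [MeasurableSpace β] {μ : Measure ℝ} [IsProbabilityMeasure μ] {s : Set ℝ}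
  {e : ℝ × β → ℝ} {B : β → ℝ}

lemma measurable_integral_fst (he : Measurable e) : Measurable fun w => ∫ x, e (x, w) ∂μ :=
  (he.stronglyMeasurable.integral_prod_left' (μ := μ)).measurable

lemma average_mem_Icc_exp (hs : μ sᶜ = 0) (he : Measurable e) (he0 : ∀ p, 0 < e p)
    (hB : ∀ x ∈ s, ∀ w, |log (e (x, w))| ≤ B w) (w : β) :
    Integrable (fun x => e (x, w)) μ ∧
      ∫ x, e (x, w) ∂μ ∈ Icc (rexp (-B w)) (rexp (B w)) := by
  have h : ∀ᵐ x ∂μ, e (x, w) ∈ Icc (rexp (-B w)) (rexp (B w)) := by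
    filter_upwards [ae_mem_of_measure_compl hs] with x hx
    have := abs_le.1 (hB x hx w)
    rwa [le_log_iff_exp_le (he0 _), log_le_iff_le_exp (he0 _)] at this
  have hi : Integrable (fun x => e (x, w)) μ :=
    Integrable.of_mem_Icc _ _ (by fun_prop) h
  refine ⟨hi, ?_, ?_⟩
  · simpa using integral_mono_ae (integrable_const _) hi (h.mono fun x hx => hx.1)
  · simpa using integral_mono_ae hi (integrable_const _) (h.mono fun x hx => hx.2)

lemma average_pos (hs : μ sᶜ = 0) (he : Measurable e) (he0 : ∀ p, 0 < e p)
    (hB : ∀ x ∈ s, ∀ w, |log (e (x, w))| ≤ B w) (w : β) : 0 < ∫ x, e (x, w) ∂μ :=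
  (exp_pos _).trans_le (average_mem_Icc_exp hs he he0 hB w).2.1

lemma abs_log_average_le (hs : μ sᶜ = 0) (he : Measurable e) (he0 : ∀ p, 0 < e p)
    (hB : ∀ x ∈ s, ∀ w, |log (e (x, w))| ≤ B w) (w : β) :
    |log (∫ x, e (x, w) ∂μ)| ≤ B w := by
  have := (average_mem_Icc_exp hs he he0 hB w).2
  rw [abs_le, le_log_iff_exp_le (average_pos hs he he0 hB w),
    log_le_iff_le_exp (average_pos hs he he0 hB w)]
  exact this

lemma lintegral_eq_ofReal_average (hs : μ sᶜ = 0) (he : Measurable e) (he0 : ∀ p, 0 < e p)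
    (hB : ∀ x ∈ s, ∀ w, |log (e (x, w))| ≤ B w) (w : β) :
    ∫⁻ x, ENNReal.ofReal (e (x, w)) ∂μ = ENNReal.ofReal (∫ x, e (x, w) ∂μ) :=
  (ofReal_integral_eq_lintegral_ofReal (average_mem_Icc_exp hs he he0 hB w).1
    (ae_of_all _ fun _ => (he0 _).le)).symm

end Average

/-- The likelihood ratio of the law of `(Y, Z)` given `X = x` to that given `X = 0`. -/
def pairRatio (vD vE : ℝ) (p : ℝ × ℝ × ℝ) : ℝ :=
  gaussianRatio vD p.1 p.2.1 * gaussianRatio vE p.1 p.2.2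

/-- The likelihood ratio of the law of `Z` given `X = x` to that given `X = 0`. -/
def singleRatio (vE : ℝ) (p : ℝ × ℝ) : ℝ := gaussianRatio vE p.1 p.2

@[fun_prop]
lemma measurable_pairRatio (vD vE : ℝ) : Measurable (pairRatio vD vE) := by
  unfold pairRatio; fun_prop

@[fun_prop]
lemma measurable_singleRatio (vE : ℝ) : Measurable (singleRatio vE) := by
  unfold singleRatio; fun_prop

lemma pairRatio_pos (vD vE : ℝ) (p) : 0 < pairRatio vD vE p :=
  mul_pos (exp_pos _) (exp_pos _)

lemma singleRatio_pos (vE : ℝ) (p) : 0 < singleRatio vE p := exp_pos _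

lemma abs_log_singleRatio_le {A vE : ℝ} (hvE : 0 < vE) :
    ∀ x ∈ Icc (-A) A, ∀ w, |log (singleRatio vE (x, w))| ≤ (A * |w| + A ^ 2 / 2) / vE :=
  fun _ hx w => abs_log_gaussianRatio_le hvE hx w

lemma abs_log_pairRatio_le {A vD vE : ℝ} (hvD : 0 < vD) (hvE : 0 < vE) :
    ∀ x ∈ Icc (-A) A, ∀ w, |log (pairRatio vD vE (x, w))| ≤
      (A * |w.1| + A ^ 2 / 2) / vD + (A * |w.2| + A ^ 2 / 2) / vE := by
  intro x hx w
  rw [pairRatio, log_mul (gaussianRatio_pos _ _ _).ne' (gaussianRatio_pos _ _ _).ne']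
  exact (abs_add_le _ _).trans
    (add_le_add (abs_log_gaussianRatio_le hvD hx _) (abs_log_gaussianRatio_le hvE hx _))

section Channel

variable {μ : Measure ℝ} {vD vE : NNReal}

/-- The joint law of the input and two independent centred Gaussian noises. -/
def noisyChannel (μ : Measure ℝ) (vD vE : NNReal) : Measure (ℝ × ℝ × ℝ) :=
  μ.prod ((gaussianReal 0 vD).prod (gaussianReal 0 vE))

instance [IsProbabilityMeasure μ] : IsProbabilityMeasure (noisyChannel μ vD vE) := by
  unfold noisyChannel; infer_instance

lemma map_Xc_noisyChannel : (noisyChannel μ vD vE).map Xc = μ := by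
  have : Xc = Prod.fst := rfl
  rw [this, noisyChannel, Measure.map_fst_prod]; simp

@[fun_prop] lemma measurable_Xc : Measurable Xc := by unfold Xc; fun_prop
@[fun_prop] lemma measurable_Yc : Measurable Yc := by unfold Yc; fun_prop
@[fun_prop] lemma measurable_Zc : Measurable Zc := by unfold Zc; fun_prop

lemma lintegral_noisyChannel (hD : vD ≠ 0) (hE : vE ≠ 0) {f : ℝ × ℝ × ℝ → ENNReal}
    (hf : Measurable f) :
    ∫⁻ ω, f (Xc ω, Yc ω, Zc ω) ∂noisyChannel μ vD vE =
      ∫⁻ p, ENNReal.ofReal (pairRatio vD vE p) * f p ∂noisyChannel μ vD vE := by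
  unfold noisyChannel
  rw [lintegral_prod _ (by fun_prop), lintegral_prod _ (by fun_prop)]
  refine lintegral_congr fun x => ?_
  rw [lintegral_prod _ (by fun_prop), lintegral_prod _ (by fun_prop)]
  simp only [Xc, Yc, Zc]
  have h1 : ∀ n, ∫⁻ k, f (x, x + n, x + k) ∂gaussianReal 0 vE =
      ∫⁻ z, ENNReal.ofReal (gaussianRatio vE x z) * f (x, x + n, z) ∂gaussianReal 0 vE :=
    fun n => lintegral_add_gaussianReal x hE (f := fun z => f (x, x + n, z)) (by fun_prop)
  simp_rw [h1]
  rw [lintegral_add_gaussianReal x hD (f := fun y =>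
    ∫⁻ z, ENNReal.ofReal (gaussianRatio vE x z) * f (x, y, z) ∂gaussianReal 0 vE)
    (Measurable.lintegral_prod_right' (f := fun q : ℝ × ℝ =>
      ENNReal.ofReal (gaussianRatio vE x q.2) * f (x, q.1, q.2)) (by fun_prop))]
  refine lintegral_congr fun y => ?_
  rw [← lintegral_const_mul _ (by fun_prop)]
  refine lintegral_congr fun z => ?_
  rw [pairRatio, ENNReal.ofReal_mul (gaussianRatio_pos _ _ _).le, mul_assoc]

lemma map_pair_noisyChannel (hD : vD ≠ 0) (hE : vE ≠ 0) :
    (noisyChannel μ vD vE).map (fun ω => (Xc ω, Yc ω, Zc ω)) =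
      (((noisyChannel μ vD vE).map Xc).prod
        ((gaussianReal 0 vD).prod (gaussianReal 0 vE))).withDensity
        (fun p => ENNReal.ofReal (pairRatio vD vE p)) := by
  rw [map_Xc_noisyChannel]
  refine Measure.ext_of_lintegral _ fun f hf => ?_
  rw [lintegral_map hf (by fun_prop), lintegral_noisyChannel hD hE hf,
    lintegral_withDensity_eq_lintegral_mul _ (by fun_prop) hf]
  rfl

lemma map_single_noisyChannel (hE : vE ≠ 0) :
    (noisyChannel μ vD vE).map (fun ω => (Xc ω, Zc ω)) =
      (((noisyChannel μ vD vE).map Xc).prod (gaussianReal 0 vE)).withDensity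
        (fun p => ENNReal.ofReal (singleRatio vE p)) := by
  rw [map_Xc_noisyChannel]
  refine Measure.ext_of_lintegral _ fun f hf => ?_
  rw [lintegral_map hf (by fun_prop),
    lintegral_withDensity_eq_lintegral_mul _ (by fun_prop) hf, noisyChannel,
    lintegral_prod _ (by fun_prop), lintegral_prod _ (by fun_prop)]
  refine lintegral_congr fun x => ?_
  rw [lintegral_prod _ (by fun_prop)]
  simp only [Xc, Zc, lintegral_const, measure_univ, mul_one]
  exact lintegral_add_gaussianReal x hE (f := fun z => f (x, z)) (by fun_prop)

variable [IsProbabilityMeasure μ] {A : ℝ}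

lemma integrable_pow_of_measure_Icc_compl (hμ : μ (Icc (-A) A)ᶜ = 0) (k : ℕ) :
    Integrable (fun x => x ^ k) μ := by
  refine Integrable.of_bound (by fun_prop) (A ^ k) ?_
  filter_upwards [ae_mem_of_measure_compl hμ] with x hx
  rw [norm_pow]
  exact pow_le_pow_left₀ (norm_nonneg _) (abs_le.2 hx) k

lemma integrable_pow_gaussianReal (v : NNReal) (k : ℕ) :
    Integrable (fun x => x ^ k) (gaussianReal 0 v) := by
  have h := (memLp_id_gaussianReal (μ := 0) (v := v) k).integrable_norm_pow'
  refine (integrable_norm_iff (by fun_prop)).1 ?_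
  simpa using h

lemma integrable_monomial (hμ : μ (Icc (-A) A)ᶜ = 0) (i j k : ℕ) :
    Integrable (fun ω => ω.1 ^ i * (ω.2.1 ^ j * ω.2.2 ^ k)) (noisyChannel μ vD vE) :=
  (integrable_pow_of_measure_Icc_compl hμ i).mul_prod
    ((integrable_pow_gaussianReal vD j).mul_prod (integrable_pow_gaussianReal vE k))

lemma integral_monomial (i j k : ℕ) :
    ∫ ω, ω.1 ^ i * (ω.2.1 ^ j * ω.2.2 ^ k) ∂noisyChannel μ vD vE =
      (∫ x, x ^ i ∂μ) * ((∫ n, n ^ j ∂gaussianReal 0 vD) * ∫ n, n ^ k ∂gaussianReal 0 vE) := by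
  unfold noisyChannel
  rw [integral_prod_mul (fun x : ℝ => x ^ i) (fun q : ℝ × ℝ => q.1 ^ j * q.2 ^ k),
    integral_prod_mul (fun x : ℝ => x ^ j) (fun x : ℝ => x ^ k)]

lemma integral_sq_gaussianReal (v : NNReal) : ∫ n, n ^ 2 ∂gaussianReal 0 v = v := by
  have h := variance_fun_id_gaussianReal (μ := 0) (v := v)
  rw [variance_eq_integral (by fun_prop)] at h
  simpa using h

lemma integrable_affine (hμ : μ (Icc (-A) A)ᶜ = 0) :
    Integrable Xc (noisyChannel μ vD vE) ∧ Integrable Yc (noisyChannel μ vD vE) ∧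
      Integrable Zc (noisyChannel μ vD vE) := by
  have hX := integrable_monomial (vD := vD) (vE := vE) hμ 1 0 0
  have hN := integrable_monomial (vD := vD) (vE := vE) hμ 0 1 0
  have hM := integrable_monomial (vD := vD) (vE := vE) hμ 0 0 1
  simp only [pow_one, pow_zero, mul_one, one_mul] at hX hN hM
  exact ⟨hX, hX.add hN, hX.add hM⟩

lemma hasIntegral_log_gaussianRatio (hμ : μ (Icc (-A) A)ᶜ = 0) :
    (Integrable (fun ω => log (gaussianRatio vD (Xc ω) (Yc ω))) (noisyChannel μ vD vE) ∧
      ∫ ω, log (gaussianRatio vD (Xc ω) (Yc ω)) ∂noisyChannel μ vD vE =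
        (∫ x, x ^ 2 ∂μ) / (2 * vD)) ∧
    (Integrable (fun ω => log (gaussianRatio vE (Xc ω) (Zc ω))) (noisyChannel μ vD vE) ∧
      ∫ ω, log (gaussianRatio vE (Xc ω) (Zc ω)) ∂noisyChannel μ vD vE =
        (∫ x, x ^ 2 ∂μ) / (2 * vE)) := by
  have hXX := integrable_monomial (vD := vD) (vE := vE) hμ 2 0 0
  have hXN := integrable_monomial (vD := vD) (vE := vE) hμ 1 1 0
  have hXM := integrable_monomial (vD := vD) (vE := vE) hμ 1 0 1
  have eD : (fun ω => log (gaussianRatio vD (Xc ω) (Yc ω))) = fun ω : ℝ × ℝ × ℝ =>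
      (1 / (2 * vD) : ℝ) * (ω.1 ^ 2 * (ω.2.1 ^ 0 * ω.2.2 ^ 0)) +
        (1 / vD : ℝ) * (ω.1 ^ 1 * (ω.2.1 ^ 1 * ω.2.2 ^ 0)) := by
    ext ω; simp only [gaussianRatio, log_exp, Xc, Yc]; ring
  have eE : (fun ω => log (gaussianRatio vE (Xc ω) (Zc ω))) = fun ω : ℝ × ℝ × ℝ =>
      (1 / (2 * vE) : ℝ) * (ω.1 ^ 2 * (ω.2.1 ^ 0 * ω.2.2 ^ 0)) +
        (1 / vE : ℝ) * (ω.1 ^ 1 * (ω.2.1 ^ 0 * ω.2.2 ^ 1)) := by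
    ext ω; simp only [gaussianRatio, log_exp, Xc, Zc]; ring
  rw [eD, eE]
  refine ⟨⟨(hXX.const_mul _).add (hXN.const_mul _), ?_⟩,
    (hXX.const_mul _).add (hXM.const_mul _), ?_⟩
  · rw [integral_add (hXX.const_mul _) (hXN.const_mul _), integral_const_mul, integral_const_mul,
      integral_monomial, integral_monomial]
    simp only [pow_one, pow_zero, integral_id_gaussianReal, integral_const, probReal_univ,
      smul_eq_mul]
    ring
  · rw [integral_add (hXX.const_mul _) (hXM.const_mul _), integral_const_mul, integral_const_mul,
      integral_monomial, integral_monomial]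
    simp only [pow_one, pow_zero, integral_id_gaussianReal, integral_const, probReal_univ,
      smul_eq_mul]
    ring

/-- The density of the law of `(Y, Z)` with respect to the law of the noise. -/
def pairDensity (μ : Measure ℝ) (vD vE : NNReal) (w : ℝ × ℝ) : ℝ :=
  ∫ x, pairRatio vD vE (x, w) ∂μ

/-- The density of the law of `Z` with respect to the law of the noise. -/
def singleDensity (μ : Measure ℝ) (vE : NNReal) (z : ℝ) : ℝ :=
  ∫ x, singleRatio vE (x, z) ∂μ

@[fun_prop]
lemma measurable_pairDensity : Measurable (pairDensity μ vD vE) :=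
  measurable_integral_fst (measurable_pairRatio _ _)

@[fun_prop]
lemma measurable_singleDensity : Measurable (singleDensity μ vE) :=
  measurable_integral_fst (measurable_singleRatio _)

lemma pairDensity_pos (hD : vD ≠ 0) (hE : vE ≠ 0) (hμ : μ (Icc (-A) A)ᶜ = 0) (w : ℝ × ℝ) :
    0 < pairDensity μ vD vE w :=
  average_pos hμ (measurable_pairRatio _ _) (pairRatio_pos _ _)
    (abs_log_pairRatio_le (NNReal.coe_pos.2 hD.bot_lt) (NNReal.coe_pos.2 hE.bot_lt)) w

lemma singleDensity_pos (hE : vE ≠ 0) (hμ : μ (Icc (-A) A)ᶜ = 0) (z : ℝ) :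
    0 < singleDensity μ vE z :=
  average_pos hμ (measurable_singleRatio _) (singleRatio_pos _)
    (abs_log_singleRatio_le (NNReal.coe_pos.2 hE.bot_lt)) z

lemma integrable_log_pairDensity (hD : vD ≠ 0) (hE : vE ≠ 0) (hμ : μ (Icc (-A) A)ᶜ = 0) :
    Integrable (fun ω => log (pairDensity μ vD vE (Yc ω, Zc ω))) (noisyChannel μ vD vE) := by
  obtain ⟨-, hY, hZ⟩ := integrable_affine (vD := vD) (vE := vE) hμ
  refine Integrable.mono' ((((hY.abs.const_mul A).add (integrable_const (A ^ 2 / 2))).div_const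
    vD).add (((hZ.abs.const_mul A).add (integrable_const (A ^ 2 / 2))).div_const vE))
    (Measurable.aestronglyMeasurable (by fun_prop)) (ae_of_all _ fun ω => ?_)
  exact abs_log_average_le hμ (measurable_pairRatio _ _) (pairRatio_pos _ _)
    (abs_log_pairRatio_le (NNReal.coe_pos.2 hD.bot_lt) (NNReal.coe_pos.2 hE.bot_lt)) _

lemma integrable_log_singleDensity (hE : vE ≠ 0) (hμ : μ (Icc (-A) A)ᶜ = 0) :
    Integrable (fun ω => log (singleDensity μ vE (Zc ω))) (noisyChannel μ vD vE) := by
  obtain ⟨-, -, hZ⟩ := integrable_affine (vD := vD) (vE := vE) hμ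
  refine Integrable.mono' (((hZ.abs.const_mul A).add (integrable_const (A ^ 2 / 2))).div_const vE)
    (Measurable.aestronglyMeasurable (by fun_prop)) (ae_of_all _ fun ω => ?_)
  exact abs_log_average_le hμ (measurable_singleRatio _) (singleRatio_pos _)
    (abs_log_singleRatio_le (NNReal.coe_pos.2 hE.bot_lt)) _

lemma lintegral_pairRatio_map (hD : vD ≠ 0) (hE : vE ≠ 0) (hμ : μ (Icc (-A) A)ᶜ = 0)
    (w : ℝ × ℝ) :
    ∫⁻ x, ENNReal.ofReal (pairRatio vD vE (x, w)) ∂((noisyChannel μ vD vE).map Xc) =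
      ENNReal.ofReal (pairDensity μ vD vE w) := by
  rw [map_Xc_noisyChannel]
  exact lintegral_eq_ofReal_average hμ (measurable_pairRatio _ _) (pairRatio_pos _ _)
    (abs_log_pairRatio_le (NNReal.coe_pos.2 hD.bot_lt) (NNReal.coe_pos.2 hE.bot_lt)) w

lemma lintegral_singleRatio (hE : vE ≠ 0) (hμ : μ (Icc (-A) A)ᶜ = 0) (z : ℝ) :
    ∫⁻ x, ENNReal.ofReal (singleRatio vE (x, z)) ∂μ = ENNReal.ofReal (singleDensity μ vE z) :=
  lintegral_eq_ofReal_average hμ (measurable_singleRatio _) (singleRatio_pos _)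
    (abs_log_singleRatio_le (NNReal.coe_pos.2 hE.bot_lt)) z

lemma lintegral_singleDensity (hE : vE ≠ 0) (hμ : μ (Icc (-A) A)ᶜ = 0) :
    ∫⁻ z, ENNReal.ofReal (singleDensity μ vE z) ∂gaussianReal 0 vE = 1 := by
  simp_rw [← lintegral_singleRatio hE hμ]
  rw [lintegral_lintegral_swap (by fun_prop)]
  simp [singleRatio, lintegral_gaussianRatio _ hE]

lemma map_pair_eq_withDensity (hD : vD ≠ 0) (hE : vE ≠ 0) (hμ : μ (Icc (-A) A)ᶜ = 0) :
    (noisyChannel μ vD vE).map (fun ω => (Yc ω, Zc ω)) =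
      ((gaussianReal 0 vD).prod (gaussianReal 0 vE)).withDensity
        (fun w => ENNReal.ofReal (pairDensity μ vD vE w)) :=
  map_snd_eq_withDensity measurable_Xc (by fun_prop) (measurable_pairRatio _ _)
    (lintegral_pairRatio_map hD hE hμ) (map_pair_noisyChannel hD hE)

lemma map_single_eq_withDensity (hE : vE ≠ 0) (hμ : μ (Icc (-A) A)ᶜ = 0) :
    (noisyChannel μ vD vE).map Zc =
      (gaussianReal 0 vE).withDensity (fun z => ENNReal.ofReal (singleDensity μ vE z)) :=
  map_snd_eq_withDensity measurable_Xc (by fun_prop) (measurable_singleRatio _)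
    (by simpa [map_Xc_noisyChannel] using lintegral_singleRatio hE hμ) (map_single_noisyChannel hE)

lemma mutualInfo_pair_sub_mutualInfo_single (hD : vD ≠ 0) (hE : vE ≠ 0)
    (hμ : μ (Icc (-A) A)ᶜ = 0) :
    mutualInfo (noisyChannel μ vD vE) Xc (fun ω => (Yc ω, Zc ω)) -
        mutualInfo (noisyChannel μ vD vE) Xc Zc =
      (((∫ x, x ^ 2 ∂μ) / (2 * vD) -
        (∫ ω, log (pairDensity μ vD vE (Yc ω, Zc ω)) ∂noisyChannel μ vD vE -
          ∫ ω, log (singleDensity μ vE (Zc ω)) ∂noisyChannel μ vD vE) : ℝ) : EReal) := by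
  obtain ⟨⟨iD, hiD⟩, iE, hiE⟩ := hasIntegral_log_gaussianRatio (vD := vD) (vE := vE) hμ
  have i2 := integrable_log_pairDensity hD hE hμ
  have i1 := integrable_log_singleDensity (vD := vD) hE hμ
  have hlog : (fun ω => log (pairRatio vD vE (Xc ω, Yc ω, Zc ω))) = fun ω =>
      log (gaussianRatio vD (Xc ω) (Yc ω)) + log (gaussianRatio vE (Xc ω) (Zc ω)) := by
    ext ω
    rw [pairRatio, log_mul (gaussianRatio_pos _ _ _).ne' (gaussianRatio_pos _ _ _).ne']
  have ip : Integrable (fun ω => log (pairRatio vD vE (Xc ω, Yc ω, Zc ω)))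
      (noisyChannel μ vD vE) := hlog ▸ iD.add iE
  have is : Integrable (fun ω => log (singleRatio vE (Xc ω, Zc ω))) (noisyChannel μ vD vE) := iE
  rw [mutualInfo_eq_integral_log measurable_Xc (by fun_prop) (measurable_pairRatio vD vE)
      (pairRatio_pos _ _) measurable_pairDensity (pairDensity_pos hD hE hμ)
      (lintegral_pairRatio_map hD hE hμ) (map_pair_noisyChannel hD hE) (ip.sub i2),
    mutualInfo_eq_integral_log measurable_Xc (by fun_prop) (measurable_singleRatio vE)
      (singleRatio_pos _) measurable_singleDensity (singleDensity_pos hE hμ)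
      (by simpa [map_Xc_noisyChannel] using lintegral_singleRatio hE hμ)
      (map_single_noisyChannel hE) (is.sub i1),
    integral_sub ip i2, integral_sub is i1, hlog, integral_add iD iE, hiD, ← EReal.coe_sub]
  congr 1
  have : ∫ ω, log (singleRatio vE (Xc ω, Zc ω)) ∂noisyChannel μ vD vE =
    (∫ x, x ^ 2 ∂μ) / (2 * vE) := hiE
  rw [this, hiE]
  ring

lemma integral_log_singleDensity_le (hD : vD ≠ 0) (hE : vE ≠ 0) (hμ : μ (Icc (-A) A)ᶜ = 0) :
    ∫ ω, log (singleDensity μ vE (Zc ω)) ∂noisyChannel μ vD vE ≤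
      ∫ ω, log (pairDensity μ vD vE (Yc ω, Zc ω)) ∂noisyChannel μ vD vE := by
  have i2 := integrable_log_pairDensity hD hE hμ
  have i1 := integrable_log_singleDensity (vD := vD) hE hμ
  have h1 : ∫⁻ w : ℝ × ℝ, ENNReal.ofReal (singleDensity μ vE w.2)
      ∂(gaussianReal 0 vD).prod (gaussianReal 0 vE) = 1 := by
    rw [lintegral_prod _ (by fun_prop)]
    simp [lintegral_singleDensity hE hμ]
  have hYZ : Measurable fun ω => (Yc ω, Zc ω) := by fun_prop
  have hb : Measurable fun w : ℝ × ℝ => singleDensity μ vE w.2 := by fun_prop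
  have := integral_log_sub_log_nonneg (b := fun w => singleDensity μ vE w.2) hYZ
    measurable_pairDensity hb (pairDensity_pos hD hE hμ)
    (fun w => singleDensity_pos hE hμ w.2) (map_pair_eq_withDensity hD hE hμ) h1 (i2.sub i1)
  rw [integral_sub i2 i1] at this
  linarith

lemma integral_log_singleDensity_nonneg (hE : vE ≠ 0) (hμ : μ (Icc (-A) A)ᶜ = 0) :
    0 ≤ ∫ ω, log (singleDensity μ vE (Zc ω)) ∂noisyChannel μ vD vE := by
  have i1 := integrable_log_singleDensity (vD := vD) hE hμ
  simpa using integral_log_sub_log_nonneg (b := fun _ => 1) measurable_Zc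
    measurable_singleDensity measurable_const (singleDensity_pos hE hμ)
    (fun _ => one_pos) (map_single_eq_withDensity (vD := vD) hE hμ) (by simp) (by simpa using i1)

lemma integral_sq_le (hμ : μ (Icc (-A) A)ᶜ = 0) : ∫ x, x ^ 2 ∂μ ≤ A ^ 2 := by
  calc ∫ x, x ^ 2 ∂μ ≤ ∫ _, A ^ 2 ∂μ := by
        refine integral_mono_ae (integrable_pow_of_measure_Icc_compl hμ 2) (integrable_const _) ?_
        filter_upwards [ae_mem_of_measure_compl hμ] with x hx
        exact sq_le_sq' hx.1 hx.2
    _ = A ^ 2 := by simp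

end Channel

/-- The uniform law on `{-A, A}`. -/
def symmetricTwoPoint (A : ℝ) : Measure ℝ :=
  (2⁻¹ : NNReal) • Measure.dirac (-A) + (2⁻¹ : NNReal) • Measure.dirac A

instance (A : ℝ) : IsProbabilityMeasure (symmetricTwoPoint A) := by
  constructor
  simp only [symmetricTwoPoint, Measure.add_apply, Measure.smul_apply, measure_univ]
  simp [ENNReal.smul_def, ENNReal.inv_two_add_inv_two]

lemma symmetricTwoPoint_Icc_compl {A : ℝ} (hA : 0 < A) :
    symmetricTwoPoint A (Icc (-A) A)ᶜ = 0 := by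
  have : -A ≤ A := by linarith
  simp [symmetricTwoPoint, this]

lemma integral_symmetricTwoPoint (A : ℝ) (f : ℝ → ℝ) :
    ∫ x, f x ∂symmetricTwoPoint A = (f (-A) + f A) / 2 := by
  have hi : ∀ a : ℝ, Integrable f ((2⁻¹ : NNReal) • Measure.dirac a) := fun a =>
    (integrable_dirac (by simp)).smul_measure_nnreal
  rw [symmetricTwoPoint, integral_add_measure (hi _) (hi _), integral_smul_nnreal_measure,
    integral_smul_nnreal_measure, integral_dirac, integral_dirac]
  simp only [NNReal.smul_def, NNReal.coe_inv, NNReal.coe_ofNat, smul_eq_mul]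
  ring

lemma log_pairDensity_symmetricTwoPoint_le {A : ℝ} (vD vE : NNReal) (y z : ℝ) :
    log (pairDensity (symmetricTwoPoint A) vD vE (y, z)) ≤
      A ^ 2 / 2 * (y / vD + z / vE) ^ 2 - A ^ 2 / 2 * (1 / vD + 1 / vE) := by
  have h : pairDensity (symmetricTwoPoint A) vD vE (y, z) =
      Real.cosh (A * (y / vD + z / vE)) * rexp (-(A ^ 2 / 2 * (1 / vD + 1 / vE))) := by
    rw [pairDensity, integral_symmetricTwoPoint, Real.cosh_eq, div_mul_eq_mul_div, add_mul,
      ← exp_add, ← exp_add]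
    simp only [pairRatio, gaussianRatio, ← exp_add]
    rw [add_comm]
    congr 3 <;> ring
  rw [h, log_le_iff_le_exp (mul_pos (cosh_pos _) (exp_pos _)), sub_eq_add_neg, exp_add]
  gcongr
  refine (cosh_le_exp_half_sq _).trans_eq ?_
  congr 1
  ring

lemma integral_log_pairDensity_symmetricTwoPoint_le {A : ℝ} (hA : 0 < A) {vD vE : NNReal}
    (hD : vD ≠ 0) (hE : vE ≠ 0) :
    ∫ ω, log (pairDensity (symmetricTwoPoint A) vD vE (Yc ω, Zc ω))
        ∂noisyChannel (symmetricTwoPoint A) vD vE ≤ (1 / vD + 1 / vE) ^ 2 * A ^ 4 / 2 := by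
  have hμ := symmetricTwoPoint_Icc_compl hA
  have hv : (vD : ℝ) ≠ 0 := by exact_mod_cast hD
  have hw : (vE : ℝ) ≠ 0 := by exact_mod_cast hE
  set s : ℝ := 1 / vD + 1 / vE with hs
  have hX := (integrable_monomial (vD := vD) (vE := vE) hμ 2 0 0).const_mul (A ^ 2 / 2 * s ^ 2)
  have hN := (integrable_monomial (vD := vD) (vE := vE) hμ 0 2 0).const_mul (A ^ 2 / (2 * vD ^ 2))
  have hM := (integrable_monomial (vD := vD) (vE := vE) hμ 0 0 2).const_mul (A ^ 2 / (2 * vE ^ 2))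
  have hXN := (integrable_monomial (vD := vD) (vE := vE) hμ 1 1 0).const_mul (A ^ 2 * s / vD)
  have hXM := (integrable_monomial (vD := vD) (vE := vE) hμ 1 0 1).const_mul (A ^ 2 * s / vE)
  have hNM := (integrable_monomial (vD := vD) (vE := vE) hμ 0 1 1).const_mul (A ^ 2 / (vD * vE))
  have hc := integrable_const (μ := noisyChannel (symmetricTwoPoint A) vD vE) (A ^ 2 / 2 * s)
  have hS := ((((hX.add hN).add hM).add hXN).add hXM).add hNM
  refine (integral_mono (integrable_log_pairDensity hD hE hμ) (hS.sub hc) fun ω => ?_).trans_eq ?_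
  · refine (log_pairDensity_symmetricTwoPoint_le vD vE _ _).trans_eq ?_
    simp only [Yc, Zc, Pi.add_apply, Pi.sub_apply, hs]
    field_simp
    ring
  · rw [integral_sub' hS hc, integral_add' _ hNM, integral_add' _ hXM, integral_add' _ hXN,
      integral_add' _ hM, integral_add' hX hN]
    rotate_left
    · exact hX.add hN
    · exact (hX.add hN).add hM
    · exact ((hX.add hN).add hM).add hXN
    · exact (((hX.add hN).add hM).add hXN).add hXM
    simp only [integral_const_mul, integral_monomial]
    simp only [pow_one, pow_zero, integral_id_gaussianReal,
      integral_const, probReal_univ, smul_eq_mul, integral_sq_gaussianReal,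
      integral_symmetricTwoPoint, hs]
    field_simp
    ring

lemma skRate_le {σD σE A : ℝ} (hσD : 0 < σD) (hσE : 0 < σE) {μ : Measure ℝ}
    [IsProbabilityMeasure μ] (hμ : μ (Icc (-A) A)ᶜ = 0) :
    skRate σD σE μ ≤ ((A ^ 2 / (2 * σD ^ 2) : ℝ) : EReal) := by
  have hD : (σD ^ 2).toNNReal ≠ 0 := (toNNReal_pos.2 (by positivity)).ne'
  have hE : (σE ^ 2).toNNReal ≠ 0 := (toNNReal_pos.2 (by positivity)).ne'
  refine (mutualInfo_pair_sub_mutualInfo_single hD hE hμ).trans_le (EReal.coe_le_coe_iff.2 ?_)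
  have h1 := integral_log_singleDensity_le hD hE hμ
  have h2 := integral_sq_le hμ
  rw [coe_toNNReal _ (by positivity)]
  have h3 : (∫ x, x ^ 2 ∂μ) / (2 * σD ^ 2) ≤ A ^ 2 / (2 * σD ^ 2) := by gcongr
  linarith

lemma le_skRate_symmetricTwoPoint {σD σE A : ℝ} (hσD : 0 < σD) (hσE : 0 < σE) (hA : 0 < A) :
    ((A ^ 2 / (2 * σD ^ 2) - (1 / σD ^ 2 + 1 / σE ^ 2) ^ 2 * A ^ 4 / 2 : ℝ) : EReal) ≤
      skRate σD σE (symmetricTwoPoint A) := by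
  have hD : (σD ^ 2).toNNReal ≠ 0 := (toNNReal_pos.2 (by positivity)).ne'
  have hE : (σE ^ 2).toNNReal ≠ 0 := (toNNReal_pos.2 (by positivity)).ne'
  have hμ := symmetricTwoPoint_Icc_compl hA
  refine (EReal.coe_le_coe_iff.2 ?_).trans_eq (mutualInfo_pair_sub_mutualInfo_single hD hE hμ).symm
  have h1 := integral_log_pairDensity_symmetricTwoPoint_le hA hD hE
  have h2 := integral_log_singleDensity_nonneg (vD := (σD ^ 2).toNNReal) hE hμ
  have h3 := integral_symmetricTwoPoint A (fun x => x ^ 2)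
  simp only [neg_sq, add_self_div_two] at h3
  rw [coe_toNNReal _ (by positivity), coe_toNNReal _ (by positivity)] at h1
  rw [h3, coe_toNNReal _ (by positivity)]
  linarith

/-- For small amplitude constraint, the secret-key capacity behaves like the capacity of the
legitimate user's channel with no secrecy constraint: `C_k(A) / (A²/(2σ_D²)) → 1` as `A → 0⁺`. -/
theorem stmt7 (σD σE : ℝ) (hσD : 0 < σD) (hσE : 0 < σE) :
    Tendsto (fun A => Ck σD σE A / ((A ^ 2 / (2 * σD ^ 2) : ℝ) : EReal))
      (nhdsWithin 0 (Set.Ioi 0)) (nhds 1) := by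
  set c : ℝ := (1 / σD ^ 2 + 1 / σE ^ 2) ^ 2 * σD ^ 2 with hc
  have hlim : Tendsto (fun A : ℝ => ((1 - c * A ^ 2 : ℝ) : EReal)) (nhdsWithin 0 (Set.Ioi 0))
      (nhds 1) := by
    have h : Tendsto (fun A : ℝ => 1 - c * A ^ 2) (nhds 0) (nhds 1) := by
      have : Continuous fun A : ℝ => 1 - c * A ^ 2 := by fun_prop
      simpa using this.tendsto 0
    exact (continuous_coe_real_ereal.tendsto 1).comp (h.mono_left nhdsWithin_le_nhds)
  refine tendsto_of_tendsto_of_tendsto_of_le_of_le' hlim tendsto_const_nhds ?_ ?_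
  · filter_upwards [self_mem_nhdsWithin] with A hA
    have hA : 0 < A := hA
    rw [EReal.le_div_iff_mul_le (EReal.coe_pos.2 (by positivity)) (EReal.coe_ne_top _),
      ← EReal.coe_mul]
    refine le_trans (le_of_eq ?_) ((le_skRate_symmetricTwoPoint hσD hσE hA).trans (le_sSup
      ⟨symmetricTwoPoint A, inferInstance, symmetricTwoPoint_Icc_compl hA, rfl⟩))
    congr 1
    rw [hc]
    field_simp
  · filter_upwards [self_mem_nhdsWithin] with A hA
    have hA : 0 < A := hA
    rw [EReal.div_le_iff_le_mul (EReal.coe_pos.2 (by positivity)) (EReal.coe_ne_top _), mul_one]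
    refine sSup_le ?_
    rintro _ ⟨μ, hμ, hμA, rfl⟩
    exact skRate_le hσD hσE hμA

end
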